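/- If the Lindelöf Hypothesis holds, i.e. ζ(1/2 + it) = O(t^ε) for every ε > 0, then for every σ with 1/2 ≤ σ ≤ 1 and every ε > 0, the zero-counting function satisfies N(σ, T) = O(T^{2−2σ+ε}). -/

import Mathlib

open Complex Real

/-- The fractional part, cut off to `(1, ∞)`. -/
noncomputable def fractTail (t : ℝ) : ℂ := (Set.Ioi (1 : ℝ)).indicator (fun t ↦ ((Int.fract t : ℝ) : ℂ)) t

lemma norm_fractTail_le_one (t : ℝ) : ‖fractTail t‖ ≤ 1 := by
  rw [fractTail, Set.indicator_apply]
  split_ifs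
  · rw [Complex.norm_real, Real.norm_of_nonneg (Int.fract_nonneg t)]
    exact (Int.fract_lt_one t).le
  · simp

lemma measurable_fractTail : Measurable fractTail :=
  by
  unfold fractTail
  exact (Complex.measurable_ofReal.comp measurable_fract).indicator measurableSet_Ioi

lemma differentiableAt_mellin_fractTail {s : ℂ} (hs : s.re < 0) :
    DifferentiableAt ℂ (mellin fractTail) s := by
  refine mellin_differentiableAt_of_isBigO_rpow (a := 0) (b := s.re - 1) ?_ ?_ hs ?_ (by linarith)
  · refine MeasureTheory.LocallyIntegrable.locallyIntegrableOn ?_ _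
    refine (MeasureTheory.locallyIntegrable_const (1 : ℝ)).mono
      measurable_fractTail.aestronglyMeasurable (.of_forall fun t ↦ ?_)
    simpa using norm_fractTail_le_one t
  · refine Asymptotics.IsBigO.of_bound 1 (.of_forall fun t ↦ ?_)
    simpa using norm_fractTail_le_one t
  · refine Filter.EventuallyEq.trans_isBigO (f₂ := fun _ ↦ (0 : ℂ)) ?_
      (Asymptotics.isBigO_zero _ _)
    filter_upwards [nhdsWithin_le_nhds (Iio_mem_nhds (zero_lt_one' ℝ))] with t ht
    exact Set.indicator_of_notMem (by simpa using ht.le) _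

lemma mellin_fractTail_neg (s : ℂ) :
    mellin fractTail (-s) = ∫ t in Set.Ioi (1 : ℝ), (t : ℂ) ^ (-s - 1) * ((Int.fract t : ℝ) : ℂ) := by
  have h : ∀ t : ℝ, (t : ℂ) ^ (-s - 1) • fractTail t =
      (Set.Ioi (1 : ℝ)).indicator (fun t : ℝ ↦ (t : ℂ) ^ (-s - 1) * ((Int.fract t : ℝ) : ℂ)) t := by
    intro t
    by_cases ht : t ∈ Set.Ioi (1 : ℝ) <;> simp [fractTail, ht, Set.indicator]
  rw [mellin, MeasureTheory.setIntegral_congr_fun measurableSet_Ioi (fun t _ ↦ h t),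
    MeasureTheory.setIntegral_indicator measurableSet_Ioi]
  congr 2
  exact Set.inter_eq_right.mpr (Set.Ioi_subset_Ioi zero_le_one)

lemma norm_mellin_fractTail_neg_le {s : ℂ} (hs : 0 < s.re) :
    ‖mellin fractTail (-s)‖ ≤ 1 / s.re := by
  rw [mellin_fractTail_neg]
  have hint : MeasureTheory.IntegrableOn (fun t : ℝ ↦ t ^ (-s.re - 1)) (Set.Ioi 1) :=
    integrableOn_Ioi_rpow_of_lt (by linarith) one_pos
  refine (MeasureTheory.norm_integral_le_of_norm_le hint ?_).trans_eq ?_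
  · refine (MeasureTheory.ae_restrict_iff' measurableSet_Ioi).mpr (.of_forall fun t ht ↦ ?_)
    have ht0 : 0 < t := one_pos.trans ht
    rw [norm_mul, Complex.norm_cpow_eq_rpow_re_of_pos ht0, Complex.norm_real,
      Real.norm_of_nonneg (Int.fract_nonneg t)]
    simpa using mul_le_of_le_one_right (Real.rpow_nonneg ht0.le _) (Int.fract_lt_one t).le
  · rw [integral_Ioi_rpow_of_lt (by linarith) one_pos]
    simp

lemma riemannZeta_eq_sub_mellin_of_one_lt {s : ℂ} (hs : 1 < s.re) :
    riemannZeta s = s / (s - 1) - s * mellin fractTail (-s) := by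
  have hs0 : s - 1 ≠ 0 := by
    intro h
    rw [sub_eq_zero] at h
    simp [h] at hs
  have key := LSeries_eq_mul_integral' (1 : ℕ → ℂ) zero_le_one hs (by
    refine Asymptotics.IsBigO.of_bound 1 (.of_forall fun n ↦ ?_)
    simp)
  rw [LSeries_one_eq_riemannZeta hs] at key
  have h1 : MeasureTheory.IntegrableOn (fun t : ℝ ↦ (t : ℂ) ^ (-s)) (Set.Ioi 1) :=
    integrableOn_Ioi_cpow_of_lt (by simpa using hs) one_pos
  have h2 : MeasureTheory.IntegrableOn
      (fun t : ℝ ↦ (t : ℂ) ^ (-s - 1) * ((Int.fract t : ℝ) : ℂ)) (Set.Ioi 1) := by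
    have : MeasureTheory.IntegrableOn (fun t : ℝ ↦ (t : ℂ) ^ (-s - 1)) (Set.Ioi 1) :=
      integrableOn_Ioi_cpow_of_lt (by simp; linarith) one_pos
    refine this.mul_bdd (c := 1)
      (Complex.measurable_ofReal.comp measurable_fract).aestronglyMeasurable
      (.of_forall fun t ↦ ?_)
    simpa [abs_of_nonneg (Int.fract_nonneg t)] using (Int.fract_lt_one t).le
  have h3 : ∫ t in Set.Ioi (1 : ℝ), (∑ k ∈ Finset.Icc 1 ⌊t⌋₊, (1 : ℕ → ℂ) k) * (t : ℂ) ^ (-(s + 1))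
      = ∫ t in Set.Ioi (1 : ℝ), ((t : ℂ) ^ (-s) - (t : ℂ) ^ (-s - 1) * ((Int.fract t : ℝ) : ℂ)) := by
    refine MeasureTheory.setIntegral_congr_fun measurableSet_Ioi fun t ht ↦ ?_
    have ht0 : 0 < t := one_pos.trans ht
    have ht' : (t : ℂ) ≠ 0 := by exact_mod_cast ht0.ne'
    have hfl : ((⌊t⌋₊ : ℕ) : ℂ) = t - ((Int.fract t : ℝ) : ℂ) := by
      have := Int.self_sub_fract t
      rw [← natCast_floor_eq_intCast_floor ht0.le] at this
      rw [← Complex.ofReal_sub, this]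
      simp
    have hpow : (t : ℂ) ^ (-s) = t * (t : ℂ) ^ (-s - 1) := by
      rw [Complex.cpow_sub _ _ ht', Complex.cpow_one]; field_simp
    have : (∑ k ∈ Finset.Icc 1 ⌊t⌋₊, (1 : ℕ → ℂ) k) = ((⌊t⌋₊ : ℕ) : ℂ) := by simp
    simp only [this, hfl]
    rw [hpow, show -(s + 1) = -s - 1 by ring]
    ring
  rw [key, h3, MeasureTheory.integral_sub h1 h2, ← mellin_fractTail_neg,
    integral_Ioi_cpow_of_lt (by simpa using hs) one_pos]
  have : -s + 1 ≠ 0 := by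
    intro h; apply hs0; linear_combination -h
  simp only [Complex.ofReal_one, Complex.one_cpow]
  field_simp
  ring

lemma riemannZeta_eq_sub_mellin {s : ℂ} (hs : 0 < s.re) (h1 : s ≠ 1) :
    riemannZeta s = s / (s - 1) - s * mellin fractTail (-s) := by
  have hopen : IsOpen {z : ℂ | 0 < z.re} := isOpen_lt continuous_const Complex.continuous_re
  have hf : AnalyticOnNhd ℂ riemannZeta₁ {z : ℂ | 0 < z.re} :=
    differentiable_riemannZeta₁.differentiableOn.analyticOnNhd hopen
  have hg : AnalyticOnNhd ℂ (fun z ↦ z - z * (z - 1) * mellin fractTail (-z)) {z : ℂ | 0 < z.re} := by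
    refine DifferentiableOn.analyticOnNhd (fun z hz ↦ ?_) hopen
    have : DifferentiableAt ℂ (fun z ↦ mellin fractTail (-z)) z :=
      (differentiableAt_mellin_fractTail (s := -z) (by simpa using hz)).comp z
        differentiableAt_id.neg
    exact DifferentiableAt.differentiableWithinAt (by fun_prop)
  have hmul : ∀ z : ℂ, z ≠ 1 → riemannZeta₁ z = (z - 1) * riemannZeta z := by
    intro z hz
    rw [riemannZeta_eq_inv_sub_mul hz, mul_inv_cancel_left₀ (sub_ne_zero.mpr hz)]
  have heq : Set.EqOn riemannZeta₁ (fun z ↦ z - z * (z - 1) * mellin fractTail (-z))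
      {z : ℂ | 0 < z.re} := by
    refine hf.eqOn_of_preconnected_of_eventuallyEq hg
      (convex_halfSpace_re_gt 0).isPreconnected (z₀ := 2) (by simp) ?_
    have : {z : ℂ | 1 < z.re} ∈ nhds (2 : ℂ) :=
      (isOpen_lt continuous_const Complex.continuous_re).mem_nhds (by simp)
    filter_upwards [this] with z hz
    have hz1 : z ≠ 1 := by rintro rfl; simp at hz
    rw [hmul z hz1, riemannZeta_eq_sub_mellin_of_one_lt hz]
    have := sub_ne_zero.mpr hz1
    field_simp
  have := heq hs
  rw [hmul s h1] at this
  have h2 := sub_ne_zero.mpr h1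
  field_simp
  linear_combination this

lemma norm_riemannZeta_le {s : ℂ} (hs : 0 < s.re) (him : 1 ≤ |s.im|) :
    ‖riemannZeta s‖ ≤ ‖s‖ * (1 + 1 / s.re) := by
  have h1 : s ≠ 1 := by rintro rfl; norm_num at him
  have h2 : 1 ≤ ‖s - 1‖ := him.trans (by simpa using Complex.abs_im_le_norm (s - 1))
  rw [riemannZeta_eq_sub_mellin hs h1, mul_add]
  refine (norm_sub_le _ _).trans (add_le_add ?_ ?_)
  · rw [norm_div, mul_one]
    exact div_le_self (norm_nonneg _) h2
  · rw [norm_mul]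
    exact mul_le_mul_of_nonneg_left (norm_mellin_fractTail_neg_le hs) (norm_nonneg _)

/-- A finite set of zeros of an analytic function in a closed ball is bounded by Jensen's
inequality. -/
lemma AnalyticOnNhd.card_zeros_le {c : ℂ} {r R M : ℝ} {f : ℂ → ℂ} (hr : 0 < r) (hrR : r < R)
    (hM : 1 ≤ M) (hf : AnalyticOnNhd ℂ f (Metric.closedBall c R)) (hc : f c ≠ 0)
    (hfM : ∀ z ∈ Metric.sphere c R, ‖f z‖ ≤ M) (S : Finset ℂ)
    (hS : ∀ z ∈ S, z ∈ Metric.closedBall c r ∧ f z = 0) :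
    (S.card : ℝ) ≤ Real.log (M / ‖f c‖) / Real.log (R / r) := by
  have hR : 0 < R := hr.trans hrR
  have hfr : AnalyticOnNhd ℂ f (Metric.closedBall c r) :=
    hf.mono (Metric.closedBall_subset_closedBall hrR.le)
  have key := AnalyticOnNhd.sum_divisor_le (c := c) (r := r) (R := R) (M := M) (f := f)
    (by rwa [abs_of_pos hr]) (by rwa [abs_of_pos hr, abs_of_pos hR]) hM
    (by rwa [abs_of_pos hR]) hc (by rwa [abs_of_pos hR])
  rw [abs_of_pos hr] at key
  refine le_trans ?_ key
  set D := MeromorphicOn.divisor f (Metric.closedBall c r) with hD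
  have hfin := D.finiteSupport (isCompact_closedBall c r)
  have hnn : ∀ u, 0 ≤ D u := (MeromorphicOn.AnalyticOnNhd.divisor_nonneg hfr)
  have hpos : ∀ z ∈ S, 1 ≤ D z := by
    intro z hz
    obtain ⟨hzr, hz0⟩ := hS z hz
    have hne : analyticOrderAt f z ≠ ⊤ := by
      have hpre : IsPreconnected (Metric.closedBall c r) := (convex_closedBall c r).isPreconnected
      refine hfr.analyticOrderAt_ne_top_of_isPreconnected hpre
        (Metric.mem_closedBall_self hr.le) hzr ?_
      rw [(hfr c (Metric.mem_closedBall_self hr.le)).analyticOrderAt_eq_zero.mpr hc]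
      simp
    have h0 : analyticOrderAt f z ≠ 0 := by
      rw [(hfr z hzr).analyticOrderAt_ne_zero]; exact hz0
    rw [hD, MeromorphicOn.AnalyticOnNhd.divisor_apply hfr hzr]
    have : analyticOrderNatAt f z ≠ 0 := by
      intro h
      rw [← Nat.cast_analyticOrderNatAt hne, h] at h0
      simp at h0
    rw [← Nat.cast_analyticOrderNatAt hne]
    simp only [ENat.map_natCast, WithTop.untop₀_coe]
    have := Nat.one_le_iff_ne_zero.mpr this
    exact_mod_cast this
  have : (S.card : ℤ) ≤ ∑ᶠ u, D u := by
    rw [finsum_eq_sum_of_support_subset (s := hfin.toFinset) _ (by simp)]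
    calc (S.card : ℤ) = ∑ z ∈ S, 1 := by simp
      _ ≤ ∑ z ∈ S, D z := Finset.sum_le_sum hpos
      _ ≤ _ := by
        refine Finset.sum_le_sum_of_subset_of_nonneg (fun z hz ↦ ?_) fun z _ _ ↦ hnn z
        have := hpos z hz
        simp only [Set.Finite.mem_toFinset, Function.mem_support]
        lia
  exact_mod_cast this

/-- Mean square of an exponential polynomial, bounded in terms of the pairwise correlations. -/
lemma integral_norm_sq_sum_exp_le {ι : Type*} (s : Finset ι) (b : ι → ℂ) (l : ι → ℝ) (p q : ℝ)
    (hpq : p ≤ q) (J : ι → ι → ℝ) (hJs : ∀ n m, J n m = J m n)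
    (hJ : ∀ n ∈ s, ∀ m ∈ s, ‖∫ t in p..q, Complex.exp (((l n - l m : ℝ) : ℂ) * I * t)‖ ≤ J n m) :
    ∫ t in p..q, ‖∑ n ∈ s, b n * Complex.exp ((l n : ℂ) * I * t)‖ ^ 2 ≤
      ∑ n ∈ s, ‖b n‖ ^ 2 * ∑ m ∈ s, J n m := by
  have hpt : ∀ t : ℝ, ((‖∑ n ∈ s, b n * Complex.exp ((l n : ℂ) * I * t)‖ ^ 2 : ℝ) : ℂ) =
      ∑ n ∈ s, ∑ m ∈ s, b n * (starRingEnd ℂ) (b m) *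
        Complex.exp (((l n - l m : ℝ) : ℂ) * I * t) := by
    intro t
    rw [Complex.ofReal_pow, ← Complex.mul_conj', map_sum, Finset.sum_mul_sum]
    refine Finset.sum_congr rfl fun n _ ↦ Finset.sum_congr rfl fun m _ ↦ ?_
    rw [map_mul, ← Complex.exp_conj, mul_mul_mul_comm, ← Complex.exp_add]
    congr 2
    simp
    ring
  have hint : ((∫ t in p..q, ‖∑ n ∈ s, b n * Complex.exp ((l n : ℂ) * I * t)‖ ^ 2 : ℝ) : ℂ) =
      ∑ n ∈ s, ∑ m ∈ s, b n * (starRingEnd ℂ) (b m) *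
        ∫ t in p..q, Complex.exp (((l n - l m : ℝ) : ℂ) * I * t) := by
    rw [← intervalIntegral.integral_ofReal]
    simp_rw [hpt]
    rw [intervalIntegral.integral_finsetSum fun n _ ↦
      (by fun_prop : Continuous _).intervalIntegrable _ _]
    refine Finset.sum_congr rfl fun n _ ↦ ?_
    rw [intervalIntegral.integral_finsetSum fun m _ ↦
      (by fun_prop : Continuous _).intervalIntegrable _ _]
    exact Finset.sum_congr rfl fun m _ ↦ intervalIntegral.integral_const_mul _ _
  have hnn : 0 ≤ ∫ t in p..q, ‖∑ n ∈ s, b n * Complex.exp ((l n : ℂ) * I * t)‖ ^ 2 :=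
    intervalIntegral.integral_nonneg hpq fun t _ ↦ by positivity
  rw [← Real.norm_of_nonneg hnn, ← Complex.norm_real, hint]
  have hterm : ∀ n ∈ s, ∀ m ∈ s, ‖b n * (starRingEnd ℂ) (b m) *
      ∫ t in p..q, Complex.exp (((l n - l m : ℝ) : ℂ) * I * t)‖ ≤
      ‖b n‖ ^ 2 * J n m / 2 + ‖b m‖ ^ 2 * J n m / 2 := by
    intro n hn m hm
    rw [norm_mul, norm_mul, RCLike.norm_conj]
    have h0 : 0 ≤ J n m := (norm_nonneg _).trans (hJ n hn m hm)
    have h1 : ‖b n‖ * ‖b m‖ * ‖∫ t in p..q, Complex.exp (((l n - l m : ℝ) : ℂ) * I * t)‖ ≤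
        ‖b n‖ * ‖b m‖ * J n m := mul_le_mul_of_nonneg_left (hJ n hn m hm) (by positivity)
    nlinarith [mul_nonneg (sq_nonneg (‖b n‖ - ‖b m‖)) h0]
  calc _ ≤ ∑ n ∈ s, ∑ m ∈ s, (‖b n‖ ^ 2 * J n m / 2 + ‖b m‖ ^ 2 * J n m / 2) :=
        (norm_sum_le _ _).trans <| Finset.sum_le_sum fun n hn ↦
          (norm_sum_le _ _).trans <| Finset.sum_le_sum fun m hm ↦ hterm n hn m hm
    _ = (∑ n ∈ s, ∑ m ∈ s, ‖b n‖ ^ 2 * J n m / 2) +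
          ∑ m ∈ s, ∑ n ∈ s, ‖b n‖ ^ 2 * J n m / 2 := by
        rw [Finset.sum_comm (f := fun m n ↦ ‖b n‖ ^ 2 * J n m / 2)]
        simp_rw [Finset.sum_add_distrib]
        congr 1
        rw [Finset.sum_comm]
        exact Finset.sum_congr rfl fun n _ ↦ Finset.sum_congr rfl fun m _ ↦ by rw [hJs]
    _ = _ := by
        rw [Finset.sum_comm (f := fun m n ↦ ‖b n‖ ^ 2 * J n m / 2), ← Finset.sum_add_distrib]
        refine Finset.sum_congr rfl fun n _ ↦ ?_
        rw [Finset.mul_sum, ← Finset.sum_add_distrib]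
        exact Finset.sum_congr rfl fun m _ ↦ by ring

lemma norm_integral_exp_mul_I_le (u p q : ℝ) (hu : u ≠ 0) :
    ‖∫ t in p..q, Complex.exp ((u : ℂ) * I * t)‖ ≤ 2 / |u| := by
  have hc : (u : ℂ) * I ≠ 0 := by simp [hu]
  rw [integral_exp_mul_complex hc, norm_div, norm_mul, Complex.norm_I, mul_one, Complex.norm_real,
    Real.norm_eq_abs]
  refine div_le_div_of_nonneg_right ((norm_sub_le _ _).trans ?_) (abs_nonneg u)
  have h : ∀ x : ℝ, ‖Complex.exp ((u : ℂ) * I * x)‖ = 1 := fun x ↦ by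
    rw [show (u : ℂ) * I * x = ((u * x : ℝ) : ℂ) * I by push_cast; ring,
      Complex.norm_exp_ofReal_mul_I]
  rw [h, h]
  norm_num

lemma abs_sub_div_le_abs_log_sub_log {X n m : ℕ} (hn : n ∈ Finset.Icc 1 X)
    (hm : m ∈ Finset.Icc 1 X) :
    |(n : ℝ) - m| / X ≤ |Real.log n - Real.log m| := by
  wlog hnm : m ≤ n generalizing n m
  · rw [abs_sub_comm, abs_sub_comm (Real.log n)]
    exact this hm hn (by omega)
  rw [Finset.mem_Icc] at hn hm
  have hm0 : (0 : ℝ) < m := by exact_mod_cast hm.1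
  have hn0 : (0 : ℝ) < n := by exact_mod_cast hn.1
  have hnX : (n : ℝ) ≤ X := by exact_mod_cast hn.2
  have hnm' : (m : ℝ) ≤ n := by exact_mod_cast hnm
  have h1 := Real.one_sub_inv_le_log_of_pos (div_pos hn0 hm0)
  rw [Real.log_div hn0.ne' hm0.ne', inv_div] at h1
  refine le_trans ?_ (le_abs_self _)
  refine le_trans ?_ h1
  rw [abs_of_nonneg (by linarith), one_sub_div hn0.ne']
  exact div_le_div_of_nonneg_left (by linarith) hn0 hnX

lemma sum_Icc_inv_le (X : ℕ) : ∑ k ∈ Finset.Icc 1 X, ((k : ℝ))⁻¹ ≤ 1 + Real.log X := by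
  have := harmonic_le_one_add_log X
  rw [harmonic_eq_sum_Icc] at this
  push_cast at this
  exact this

lemma sum_inv_le_of_injOn {X : ℕ} (s : Finset ℕ) (f : ℕ → ℕ) (hf : Set.InjOn f s)
    (hmaps : ∀ m ∈ s, f m ∈ Finset.Icc 1 X) : ∑ m ∈ s, ((f m : ℝ))⁻¹ ≤ 1 + Real.log X := by
  rw [← Finset.sum_image (f := fun k : ℕ ↦ ((k : ℝ))⁻¹) hf]
  refine (Finset.sum_le_sum_of_subset_of_nonneg ?_ fun k _ _ ↦ by positivity).trans
    (sum_Icc_inv_le X)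
  exact Finset.image_subset_iff.mpr hmaps

lemma sum_Icc_inv_abs_sub_le {X n : ℕ} (hn : n ∈ Finset.Icc 1 X) :
    ∑ m ∈ Finset.Icc 1 X with m ≠ n, |(n : ℝ) - m|⁻¹ ≤ 2 * (1 + Real.log X) := by
  rw [Finset.mem_Icc] at hn
  rw [← Finset.sum_filter_add_sum_filter_not _ (fun m ↦ m < n), two_mul]
  refine add_le_add ?_ ?_
  · refine le_trans (le_of_eq ?_) (sum_inv_le_of_injOn
      {m ∈ {m ∈ Finset.Icc 1 X | m ≠ n} | m < n} (fun m ↦ n - m) ?_ ?_)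
    · refine Finset.sum_congr rfl fun m hm ↦ ?_
      have h : m < n := (Finset.mem_filter.mp hm).2
      rw [Nat.cast_sub h.le, abs_of_nonneg (by rw [sub_nonneg]; exact_mod_cast h.le)]
    · intro m hm k hk h
      simp only [Finset.coe_filter, Set.mem_ofPred_eq] at hm hk h
      lia
    · intro m hm
      simp only [Finset.mem_filter, Finset.mem_Icc] at hm ⊢
      lia
  · refine le_trans (le_of_eq ?_) (sum_inv_le_of_injOn
      {m ∈ {m ∈ Finset.Icc 1 X | m ≠ n} | ¬ m < n} (fun m ↦ m - n) ?_ ?_)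
    · refine Finset.sum_congr rfl fun m hm ↦ ?_
      have h : n ≤ m := not_lt.mp (Finset.mem_filter.mp hm).2
      rw [Nat.cast_sub h, abs_sub_comm, abs_of_nonneg (by rw [sub_nonneg]; exact_mod_cast h)]
    · intro m hm k hk h
      simp only [Finset.coe_filter, Set.mem_ofPred_eq] at hm hk h
      lia
    · intro m hm
      simp only [Finset.mem_filter, Finset.mem_Icc] at hm ⊢
      lia

/-- The partial sum `∑_{n ≤ X} μ(n) n⁻ˢ` of the Dirichlet series of `1 / ζ`. -/
noncomputable def mollifier (X : ℕ) (s : ℂ) : ℂ :=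
  ∑ n ∈ Finset.Icc 1 X, (ArithmeticFunction.moebius n : ℂ) * (n : ℂ) ^ (-s)

lemma differentiable_mollifier (X : ℕ) : Differentiable ℂ (mollifier X) := by
  unfold mollifier
  refine Differentiable.fun_sum fun n hn ↦ ?_
  have : (n : ℂ) ≠ 0 := by
    have := (Finset.mem_Icc.mp hn).1
    exact_mod_cast (by lia : n ≠ 0)
  exact (differentiable_neg.const_cpow (Or.inl this)).const_mul _

lemma norm_moebius_le_one (n : ℕ) : ‖(ArithmeticFunction.moebius n : ℂ)‖ ≤ 1 := by
  rw [Complex.norm_intCast]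
  exact_mod_cast ArithmeticFunction.abs_moebius_le_one

lemma norm_mollifier_le (X : ℕ) {s : ℂ} (hs : 0 ≤ s.re) : ‖mollifier X s‖ ≤ X := by
  refine (norm_sum_le_of_le (n := fun _ ↦ (1 : ℝ)) _ fun n hn ↦ ?_).trans (by simp)
  have hn0 := (Finset.mem_Icc.mp hn).1
  rw [norm_mul, Complex.norm_natCast_cpow_of_pos hn0]
  refine mul_le_one₀ (norm_moebius_le_one n) (by positivity) ?_
  exact Real.rpow_le_one_of_one_le_of_nonpos (by exact_mod_cast hn0) (by simpa using hs)

/-- Mean square of the mollifier on the critical line. -/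
lemma integral_norm_sq_mollifier_le (X : ℕ) {p q : ℝ} (hpq : p ≤ q) :
    ∫ t in p..q, ‖mollifier X (1 / 2 + t * I)‖ ^ 2 ≤
      (1 + Real.log X) * ((q - p) + 4 * X * (1 + Real.log X)) := by
  set b : ℕ → ℂ := fun n ↦ (ArithmeticFunction.moebius n : ℂ) * (n : ℂ) ^ (-(1 / 2) : ℂ) with hb
  set l : ℕ → ℝ := fun n ↦ -Real.log n with hl
  have hM : ∀ t : ℝ, mollifier X (1 / 2 + t * I) =
      ∑ n ∈ Finset.Icc 1 X, b n * Complex.exp ((l n : ℂ) * I * t) := by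
    intro t
    refine Finset.sum_congr rfl fun n hn ↦ ?_
    have hn0 : (n : ℂ) ≠ 0 := by
      have := (Finset.mem_Icc.mp hn).1
      exact_mod_cast (by lia : n ≠ 0)
    rw [neg_add, Complex.cpow_add _ _ hn0, ← mul_assoc]
    congr 1
    rw [Complex.cpow_def_of_ne_zero hn0, hl]
    congr 1
    push_cast
    ring
  simp_rw [hM]
  set J : ℕ → ℕ → ℝ := fun n m ↦ if m = n then q - p else 2 * X * |(n : ℝ) - m|⁻¹ with hJdef
  refine (integral_norm_sq_sum_exp_le (Finset.Icc 1 X) b l p q hpq J ?_ ?_).trans ?_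
  · intro n m
    simp only [hJdef, eq_comm, abs_sub_comm]
  · intro n hn m hm
    simp only [hJdef]
    split_ifs with h
    · subst h
      simp [-Complex.ofReal_sub, abs_of_nonneg (sub_nonneg.mpr hpq)]
    · have hne : (n : ℝ) - m ≠ 0 := by
        rw [sub_ne_zero]; exact_mod_cast Ne.symm h
      have hX : (0 : ℝ) < X := by
        have := Finset.mem_Icc.mp hn
        exact_mod_cast (by lia : 0 < X)
      have h2 := abs_sub_div_le_abs_log_sub_log hn hm
      have h1 : 0 < |(n : ℝ) - m| / X := div_pos (abs_pos.mpr hne) hX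
      have h3 : |l n - l m| = |Real.log n - Real.log m| := by
        rw [hl, abs_sub_comm]
        congr 1
        ring
      have h4 : 0 < |l n - l m| := by rw [h3]; exact h1.trans_le h2
      refine (norm_integral_exp_mul_I_le _ _ _ (abs_pos.mp h4)).trans ?_
      rw [h3]
      refine (div_le_div_of_nonneg_left zero_le_two h1 h2).trans_eq ?_
      field_simp
  · have hlog : 0 ≤ Real.log X := Real.log_natCast_nonneg X
    have hJsum : ∀ n ∈ Finset.Icc 1 X, ∑ m ∈ Finset.Icc 1 X, J n m ≤
        (q - p) + 4 * X * (1 + Real.log X) := by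
      intro n hn
      rw [← Finset.sum_filter_add_sum_filter_not _ (fun m ↦ m = n)]
      refine add_le_add (le_of_eq ?_) ?_
      · rw [Finset.filter_eq', if_pos hn]
        simp [hJdef]
      · have : ∑ m ∈ Finset.Icc 1 X with ¬ m = n, J n m =
            2 * X * ∑ m ∈ Finset.Icc 1 X with m ≠ n, |(n : ℝ) - m|⁻¹ := by
          rw [Finset.mul_sum]
          refine Finset.sum_congr rfl fun m hm ↦ ?_
          simp only [hJdef, if_neg (Finset.mem_filter.mp hm).2]
        rw [this]
        nlinarith [mul_le_mul_of_nonneg_left (sum_Icc_inv_abs_sub_le hn)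
          (Nat.cast_nonneg (α := ℝ) X)]
    have hbn : ∀ n ∈ Finset.Icc 1 X, ‖b n‖ ^ 2 ≤ ((n : ℝ))⁻¹ := by
      intro n hn
      have hn0 := (Finset.mem_Icc.mp hn).1
      have hn1 : (0 : ℝ) < n := by exact_mod_cast hn0
      rw [hb, norm_mul, Complex.norm_natCast_cpow_of_pos hn0, mul_pow]
      have h1 : ‖(ArithmeticFunction.moebius n : ℂ)‖ ^ 2 ≤ 1 :=
        pow_le_one₀ (norm_nonneg _) (norm_moebius_le_one n)
      have h2 : ((n : ℝ) ^ ((-(1 / 2) : ℂ)).re) ^ 2 = ((n : ℝ))⁻¹ := by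
        rw [← Real.rpow_natCast, ← Real.rpow_mul hn1.le, ← Real.rpow_neg_one]
        norm_num
      rw [h2]
      exact mul_le_of_le_one_left (by positivity) h1
    calc _ ≤ ∑ n ∈ Finset.Icc 1 X, ((n : ℝ))⁻¹ * ((q - p) + 4 * X * (1 + Real.log X)) := by
          refine Finset.sum_le_sum fun n hn ↦ ?_
          refine (mul_le_mul_of_nonneg_left (hJsum n hn) (by positivity)).trans ?_
          refine mul_le_mul_of_nonneg_right (hbn n hn) ?_
          have := sub_nonneg.mpr hpq
          positivity
      _ ≤ _ := by
          rw [← Finset.sum_mul]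
          refine mul_le_mul_of_nonneg_right (sum_Icc_inv_le X) ?_
          have := sub_nonneg.mpr hpq
          positivity

/-- A Dirichlet series with coefficients bounded by one and supported on `[X, ∞)`. -/
lemma norm_LSeries_le_of_support {f : ℕ → ℂ} {X : ℝ} (hX : 1 ≤ X) (hf : ∀ n, ‖f n‖ ≤ 1)
    (hsupp : ∀ n, n ≠ 0 → f n ≠ 0 → X ≤ n) {s : ℂ} (hs : 2 ≤ s.re) :
    ‖LSeries f s‖ ≤ (∑' n : ℕ, 1 / (n : ℝ) ^ 2) * X ^ (2 - s.re) := by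
  have hsum : Summable fun n : ℕ ↦ 1 / (n : ℝ) ^ 2 :=
    Real.summable_one_div_nat_pow.mpr one_lt_two
  have hX0 : 0 < X := one_pos.trans_le hX
  rw [← tsum_mul_right]
  refine tsum_of_norm_bounded (hsum.mul_right _).hasSum fun n ↦ ?_
  rcases eq_or_ne n 0 with rfl | hn
  · simp
  rw [LSeries.norm_term_eq, if_neg hn]
  by_cases h0 : f n = 0
  · rw [h0, norm_zero, zero_div]
    positivity
  have hXn := hsupp n hn h0
  have hn0 : (0 : ℝ) < n := hX0.trans_le hXn
  have h1 : (n : ℝ) ^ (2 - s.re) ≤ X ^ (2 - s.re) :=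
    Real.rpow_le_rpow_of_nonpos hX0 hXn (by linarith)
  have h2 : (n : ℝ) ^ (2 - s.re) = (n : ℝ) ^ 2 / (n : ℝ) ^ s.re := by
    rw [Real.rpow_sub hn0, Real.rpow_two]
  calc ‖f n‖ / (n : ℝ) ^ s.re ≤ 1 / (n : ℝ) ^ s.re :=
        div_le_div_of_nonneg_right (hf n) (by positivity)
    _ = 1 / (n : ℝ) ^ 2 * (n : ℝ) ^ (2 - s.re) := by
        rw [h2]; field_simp
    _ ≤ _ := mul_le_mul_of_nonneg_left h1 (by positivity)

lemma one_le_tsum_one_div_sq : 1 ≤ ∑' n : ℕ, 1 / (n : ℝ) ^ 2 := by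
  have := (Real.summable_one_div_nat_pow.mpr one_lt_two).le_tsum 1 fun n _ ↦ by positivity
  simpa using this

lemma norm_riemannZeta_le_of_two_le {s : ℂ} (hs : 2 ≤ s.re) :
    ‖riemannZeta s‖ ≤ ∑' n : ℕ, 1 / (n : ℝ) ^ 2 := by
  rw [← LSeries_one_eq_riemannZeta (by linarith)]
  simpa using norm_LSeries_le_of_support (f := 1) le_rfl (by simp)
    (fun n hn _ ↦ by exact_mod_cast Nat.one_le_iff_ne_zero.mpr hn) hs

lemma one_le_mul_norm_riemannZeta {s : ℂ} (hs : 2 ≤ s.re) :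
    1 ≤ (∑' n : ℕ, 1 / (n : ℝ) ^ 2) * ‖riemannZeta s‖ := by
  have h := congrArg norm (LSeries_one_mul_Lseries_moebius (s := s) (by linarith))
  rw [norm_mul, norm_one, LSeries_one_eq_riemannZeta (by linarith)] at h
  refine h.ge.trans ?_
  rw [mul_comm]
  refine mul_le_mul_of_nonneg_right ?_ (norm_nonneg _)
  simpa using norm_LSeries_le_of_support (f := fun n ↦ (ArithmeticFunction.moebius n : ℂ)) le_rfl
    norm_moebius_le_one (fun n hn _ ↦ by exact_mod_cast Nat.one_le_iff_ne_zero.mpr hn) hs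

/-- Far to the right, the mollifier is close to `1 / ζ`. -/
lemma norm_riemannZeta_mul_mollifier_sub_one_le {X : ℕ} (hX : 1 ≤ X) {s : ℂ} (hs : 2 ≤ s.re) :
    ‖riemannZeta s * mollifier X s - 1‖ ≤
      (∑' n : ℕ, 1 / (n : ℝ) ^ 2) ^ 2 * (X : ℝ) ^ (2 - s.re) := by
  set f : ℕ → ℂ := fun n ↦ if n ≤ X then 0 else (ArithmeticFunction.moebius n : ℂ) with hf
  set g : ℕ → ℂ := fun n ↦ if n ≤ X then (ArithmeticFunction.moebius n : ℂ) else 0 with hg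
  have hfb : ∀ n, ‖f n‖ ≤ 1 := fun n ↦ by
    simp only [hf]
    split_ifs
    · simp
    · exact norm_moebius_le_one n
  have hgb : ∀ n, ‖g n‖ ≤ 1 := fun n ↦ by
    simp only [hg]
    split_ifs
    · exact norm_moebius_le_one n
    · simp
  have hsum : ∀ u : ℕ → ℂ, (∀ n, ‖u n‖ ≤ 1) → LSeriesSummable u s := fun u hu ↦
    LSeriesSummable_of_bounded_of_one_lt_re (m := 1) (fun n _ ↦ hu n) (by linarith)
  have hgL : LSeries g s = mollifier X s := by
    rw [LSeries, tsum_eq_sum (s := Finset.Icc 1 X), mollifier]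
    · refine Finset.sum_congr rfl fun n hn ↦ ?_
      rw [Finset.mem_Icc] at hn
      rw [LSeries.term_of_ne_zero (by lia), Complex.cpow_neg, hg]
      simp only [if_pos hn.2]
      rw [div_eq_mul_inv]
    · intro n hn
      rcases eq_or_ne n 0 with rfl | hn0
      · simp
      · have : ¬ n ≤ X := fun h ↦ hn (Finset.mem_Icc.mpr ⟨by lia, h⟩)
        rw [LSeries.term_of_ne_zero hn0]
        simp [hg, this]
  have hadd : LSeries (fun n ↦ (ArithmeticFunction.moebius n : ℂ)) s = LSeries f s + LSeries g s := by
    rw [← LSeries_add (hsum f hfb) (hsum g hgb)]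
    congr 1
    ext n
    simp only [hf, hg, Pi.add_apply]
    split_ifs <;> simp
  have h := LSeries_one_mul_Lseries_moebius (s := s) (by linarith)
  rw [LSeries_one_eq_riemannZeta (by linarith)] at h
  have heq : riemannZeta s * mollifier X s - 1 = -(riemannZeta s * LSeries f s) := by
    rw [← h, hadd, hgL]
    ring
  rw [heq, norm_neg, norm_mul, sq, mul_assoc]
  refine mul_le_mul (norm_riemannZeta_le_of_two_le hs) ?_ (norm_nonneg _)
    (zero_le_one.trans one_le_tsum_one_div_sq)
  refine norm_LSeries_le_of_support (by exact_mod_cast hX) hfb (fun n _ hn ↦ ?_) hs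
  have : ¬ n ≤ X := fun h ↦ hn (by simp [hf, h])
  exact_mod_cast (not_le.mp this).le

/-- There are `O(log t)` zeros of zeta to the right of the critical line at bounded distance from
height `t`. -/
lemma exists_card_zeros_le_mul_log {B : ℝ} (hB : 0 < B) :
    ∃ C t₀ : ℝ, 0 < C ∧ 2 ≤ t₀ ∧ ∀ t : ℝ, t₀ ≤ t → ∀ S : Finset ℂ,
      (∀ ρ ∈ S, riemannZeta ρ = 0 ∧ 1 / 2 ≤ ρ.re ∧ |ρ.im - t| ≤ B) →
      (S.card : ℝ) ≤ C * Real.log t := by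
  set c : ℝ := B ^ 2 + 2 with hc
  set r : ℝ := √(c ^ 2 - 7 / 4) with hr
  have hc2 : 2 < c := by rw [hc]; nlinarith
  have hr2 : r ^ 2 = c ^ 2 - 7 / 4 := Real.sq_sqrt (by nlinarith)
  have hr0 : 0 < r := Real.sqrt_pos.mpr (by nlinarith)
  have hrc : r < c := by nlinarith
  set R : ℝ := (r + c) / 2 with hR
  have hrR : r < R := by linarith
  have hRc : R < c := by linarith
  set D : ℝ := ∑' n : ℕ, 1 / (n : ℝ) ^ 2 with hD
  have hD1 : 1 ≤ D := one_le_tsum_one_div_sq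
  set A : ℝ := 4 * (1 + 1 / (c - R)) with hA
  have hA1 : 1 ≤ A := by
    have : 0 < 1 / (c - R) := one_div_pos.mpr (by linarith)
    linarith
  have hlR : 0 < Real.log (R / r) := Real.log_pos (by rwa [one_lt_div hr0])
  refine ⟨2 / Real.log (R / r), c + 1 + A * D, by positivity, by nlinarith, fun t ht S hS ↦ ?_⟩
  have ht1 : c + 1 ≤ t := by nlinarith
  have htA : A * D ≤ t := by linarith
  set z : ℂ := c + t * I with hz
  have hre {w : ℂ} (hw : w ∈ Metric.closedBall z R) : c - R ≤ w.re ∧ w.re ≤ c + R := by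
    have h := (Complex.abs_re_le_norm (w - z)).trans (mem_closedBall_iff_norm.mp hw)
    have : (w - z).re = w.re - c := by simp [hz]
    rw [this, abs_le] at h
    constructor <;> linarith
  have him {w : ℂ} (hw : w ∈ Metric.closedBall z R) : t - R ≤ w.im ∧ w.im ≤ t + R := by
    have h := (Complex.abs_im_le_norm (w - z)).trans (mem_closedBall_iff_norm.mp hw)
    have : (w - z).im = w.im - t := by simp [hz]
    rw [this, abs_le] at h
    constructor <;> linarith
  have hana : AnalyticOnNhd ℂ riemannZeta (Metric.closedBall z R) := by
    intro w hw
    have hw1 : w ≠ 1 := by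
      rintro rfl
      have := (him hw).1
      simp at this
      linarith
    refine DifferentiableOn.analyticAt (s := {1}ᶜ) (fun u hu ↦ ?_)
      (isOpen_compl_singleton.mem_nhds hw1)
    exact (differentiableAt_riemannZeta hu).differentiableWithinAt
  have hzD : 1 ≤ D * ‖riemannZeta z‖ := one_le_mul_norm_riemannZeta (by simp [hz]; linarith)
  have hz0 : 0 < ‖riemannZeta z‖ := by
    by_contra! h
    nlinarith
  have hmax (w : ℂ) (hw : w ∈ Metric.sphere z R) : ‖riemannZeta w‖ ≤ A * t := by
    have hw' := Metric.sphere_subset_closedBall hw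
    obtain ⟨h1, h2⟩ := hre hw'
    obtain ⟨h3, h4⟩ := him hw'
    have hn : ‖w‖ ≤ 4 * t := by
      refine (Complex.norm_le_abs_re_add_abs_im w).trans ?_
      rw [abs_of_nonneg (by linarith), abs_of_nonneg (by linarith)]
      linarith
    refine (norm_riemannZeta_le (by linarith)
      (by rw [abs_of_nonneg] <;> linarith)).trans ?_
    calc ‖w‖ * (1 + 1 / w.re) ≤ (4 * t) * (1 + 1 / (c - R)) := by
          have := one_div_le_one_div_of_le (by linarith) h1
          have := one_div_pos.mpr (by linarith : 0 < w.re)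
          exact mul_le_mul hn (by linarith) (by linarith) (by linarith)
      _ = A * t := by rw [hA]; ring
  have hcard := AnalyticOnNhd.card_zeros_le hr0 hrR (by nlinarith) hana (norm_pos_iff.mp hz0) hmax S
    fun ρ hρ ↦ by
      obtain ⟨h0, h1, h2⟩ := hS ρ hρ
      refine ⟨?_, h0⟩
      have hρ1 : ρ.re < 1 := by
        by_contra! h
        exact riemannZeta_ne_zero_of_one_le_re h h0
      rw [mem_closedBall_iff_norm, Complex.norm_def]
      refine Real.sqrt_le_sqrt ?_
      rw [Complex.normSq_apply]
      simp only [hz, Complex.sub_re, Complex.sub_im, Complex.add_re, Complex.add_im,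
        Complex.ofReal_re, Complex.ofReal_im, Complex.re_ofReal_mul, Complex.im_ofReal_mul,
        Complex.I_re, Complex.I_im, mul_zero, mul_one, add_zero, zero_add]
      have := sq_le_sq' (abs_le.mp h2).1 (abs_le.mp h2).2
      nlinarith
  refine hcard.trans ?_
  rw [div_mul_eq_mul_div]
  refine div_le_div_of_nonneg_right ?_ hlR.le
  have ht0 : 0 < t := by linarith
  calc Real.log (A * t / ‖riemannZeta z‖) ≤ Real.log (t ^ 2) := by
        refine Real.log_le_log (by positivity) ?_
        rw [div_le_iff₀ hz0]
        have : A ≤ t * ‖riemannZeta z‖ := by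
          calc A ≤ A * (D * ‖riemannZeta z‖) := le_mul_of_one_le_right (by linarith) hzD
            _ = A * D * ‖riemannZeta z‖ := by ring
            _ ≤ _ := by gcongr
        nlinarith
    _ = 2 * Real.log t := by
        rw [Real.log_pow]
        norm_num

lemma integral_inv_ofReal_add {a b : ℝ} {z : ℂ} (hz : z.im ≠ 0) :
    ∫ x in a..b, ((x : ℂ) + z)⁻¹ = Complex.log (b + z) - Complex.log (a + z) := by
  have hs (x : ℝ) : (x : ℂ) + z ∈ Complex.slitPlane := Or.inr (by simpa using hz)
  refine intervalIntegral.integral_eq_sub_of_hasDerivAt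
    (f := fun x : ℝ ↦ Complex.log (x + z)) (fun x _ ↦ ?_) ?_
  · have h : HasDerivAt (fun x : ℝ ↦ (x : ℂ) + z) 1 x :=
      (HasDerivAt.ofReal_comp (hasDerivAt_id x)).add_const z
    simpa using h.clog_real (hs x)
  · refine ContinuousOn.intervalIntegrable fun x _ ↦ ContinuousAt.continuousWithinAt ?_
    exact ContinuousAt.inv₀ (by fun_prop) (Complex.slitPlane_ne_zero (hs x))

lemma mul_integral_inv_add_mul_I {p q c : ℝ} (hc : 0 < c) :
    I * ∫ y in p..q, ((c : ℂ) + y * I)⁻¹ = Complex.log (c + q * I) - Complex.log (c + p * I) := by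
  have hs (y : ℝ) : (c : ℂ) + y * I ∈ Complex.slitPlane := Or.inl (by simpa using hc)
  rw [← intervalIntegral.integral_const_mul]
  refine intervalIntegral.integral_eq_sub_of_hasDerivAt
    (f := fun y : ℝ ↦ Complex.log (c + y * I)) (fun y _ ↦ ?_) ?_
  · have h : HasDerivAt (fun y : ℝ ↦ (c : ℂ) + y * I) I y := by
      simpa using ((HasDerivAt.ofReal_comp (hasDerivAt_id y)).mul_const I).const_add (c : ℂ)
    simpa [div_eq_mul_inv] using h.clog_real (hs y)
  · refine ContinuousOn.intervalIntegrable fun x _ ↦ ContinuousAt.continuousWithinAt ?_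
    exact continuousAt_const.mul
      (ContinuousAt.inv₀ (by fun_prop) (Complex.slitPlane_ne_zero (hs x)))

lemma log_neg_of_im_neg {z : ℂ} (hz : z.im < 0) : Complex.log (-z) = Complex.log z + π * I := by
  rw [Complex.log, Complex.log, norm_neg, Complex.arg_neg_eq_arg_add_pi_of_im_neg hz]
  push_cast
  ring

/-- The boundary integral of a function over the rectangle with corners `-a - B * I` and
`b + B * I`. -/
noncomputable def rectIntegral (a b B : ℝ) (f : ℂ → ℂ) : ℂ :=
  (∫ x in (-a)..b, f (x + (-B : ℝ) * I)) - (∫ x in (-a)..b, f (x + B * I)) +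
    I * (∫ y in (-B)..B, f (b + y * I)) - I * ∫ y in (-B)..B, f ((-a : ℝ) + y * I)

lemma rectIntegral_inv {a b B : ℝ} (ha : 0 < a) (hb : 0 < b) (hB : 0 < B) :
    rectIntegral a b B (fun w ↦ w⁻¹) = 2 * π * I := by
  have h1 := integral_inv_ofReal_add (a := -a) (b := b) (z := (-B : ℝ) * I) (by simpa using hB.ne')
  have h2 := integral_inv_ofReal_add (a := -a) (b := b) (z := B * I) (by simpa using hB.ne')
  have h3 := mul_integral_inv_add_mul_I (p := -B) (q := B) hb
  have h4 : I * ∫ y in (-B)..B, (((-a : ℝ) : ℂ) + y * I)⁻¹ =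
      Complex.log (a + (-B : ℝ) * I) - Complex.log (a + B * I) := by
    have h := mul_integral_inv_add_mul_I (p := -B) (q := B) ha
    have h' : ∫ y in (-B)..B, (((-a : ℝ) : ℂ) + y * I)⁻¹ =
        -∫ y in (-B)..B, ((a : ℂ) + y * I)⁻¹ := by
      rw [← intervalIntegral.integral_neg]
      nth_rewrite 2 [← neg_neg B]
      rw [← intervalIntegral.integral_comp_neg]
      refine intervalIntegral.integral_congr fun y _ ↦ ?_
      rw [← inv_neg]
      push_cast
      ring_nf
    rw [h', mul_neg, h]
    ring
  have h5 := log_neg_of_im_neg (z := a + (-B : ℝ) * I) (by simpa using hB)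
  have h6 := log_neg_of_im_neg (z := ((-a : ℝ) : ℂ) + (-B : ℝ) * I) (by simpa using hB)
  have e5 : -((a : ℂ) + (-B : ℝ) * I) = ((-a : ℝ) : ℂ) + B * I := by push_cast; ring
  have e6 : -(((-a : ℝ) : ℂ) + (-B : ℝ) * I) = (a : ℂ) + B * I := by push_cast; ring
  rw [e5] at h5
  rw [e6] at h6
  rw [rectIntegral, h1, h2, h3, h4, h5, h6]
  ring

/-- **Cauchy's integral formula** for a rectangle around the origin. -/
lemma rectIntegral_mul_inv {a b B : ℝ} (ha : 0 < a) (hb : 0 < b) (hB : 0 < B) {f : ℂ → ℂ}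
    (hf : ∀ w ∈ Set.Icc (-a) b ×ℂ Set.Icc (-B) B, DifferentiableAt ℂ f w) :
    rectIntegral a b B (fun w ↦ f w * w⁻¹) = 2 * π * I * f 0 := by
  have hab : -a ≤ b := by linarith
  have hBB : -B ≤ B := by linarith
  have h0 : (0 : ℂ) ∈ Set.Icc (-a) b ×ℂ Set.Icc (-B) B := by
    simp [Complex.mem_reProdIm, ha.le, hb.le, hB.le]
  have hc0 : ContinuousAt (dslope f 0) 0 := continuousAt_dslope_same.mpr (hf 0 h0)
  have hd : ∀ w ∈ Set.Icc (-a) b ×ℂ Set.Icc (-B) B, w ≠ 0 → DifferentiableAt ℂ (dslope f 0) w :=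
    fun w hw hw0 ↦ (differentiableAt_dslope_of_ne hw0).mpr (hf w hw)
  have hcont : ∀ w ∈ Set.Icc (-a) b ×ℂ Set.Icc (-B) B, ContinuousAt (dslope f 0) w := by
    intro w hw
    rcases eq_or_ne w 0 with rfl | hw0
    · exact hc0
    · exact (hd w hw hw0).continuousAt
  have key := Complex.integral_boundary_rect_eq_zero_of_differentiable_on_off_countable
    (dslope f 0) (⟨-a, -B⟩ : ℂ) (⟨b, B⟩ : ℂ) {0} (Set.countable_singleton 0)
    (fun w hw ↦ (hcont w (by
      simpa only [Set.uIcc_of_le hab, Set.uIcc_of_le hBB] using hw)).continuousWithinAt)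
    (fun w hw ↦ hd w (by
      have h := hw.1
      simp only [min_eq_left hab, max_eq_right hab, min_eq_left hBB, max_eq_right hBB] at h
      exact ⟨Set.Ioo_subset_Icc_self h.1, Set.Ioo_subset_Icc_self h.2⟩) hw.2)
  have hsplit : ∀ g : ℝ → ℂ, Continuous g → ∀ p q : ℝ, p ≤ q →
      (∀ x ∈ Set.Icc p q, g x ∈ Set.Icc (-a) b ×ℂ Set.Icc (-B) B) → (∀ x, g x ≠ 0) →
      ∫ x in p..q, f (g x) * (g x)⁻¹ =
        (∫ x in p..q, dslope f 0 (g x)) + f 0 * ∫ x in p..q, (g x)⁻¹ := by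
    intro g hg p q hpq hmem hne
    rw [← intervalIntegral.integral_const_mul, ← intervalIntegral.integral_add]
    · refine intervalIntegral.integral_congr fun x _ ↦ ?_
      simp only [dslope_of_ne _ (hne x), slope_def_field]
      field_simp [hne x]
      ring
    · refine ContinuousOn.intervalIntegrable fun x hx ↦ ContinuousAt.continuousWithinAt ?_
      rw [Set.uIcc_of_le hpq] at hx
      exact ContinuousAt.comp (f := g) (hcont _ (hmem x hx)) hg.continuousAt
    · exact (continuous_const.mul (hg.inv₀ hne)).intervalIntegrable _ _
  have hinv := rectIntegral_inv ha hb hB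
  rw [rectIntegral] at hinv ⊢
  rw [hsplit (fun x ↦ x + (-B : ℝ) * I) (by fun_prop) _ _ hab, hsplit (fun x ↦ x + B * I) (by fun_prop) _ _ hab,
    hsplit (fun y ↦ b + y * I) (by fun_prop) _ _ hBB, hsplit (fun y ↦ (-a : ℝ) + y * I) (by fun_prop) _ _ hBB]
  · simp only [smul_eq_mul] at key
    linear_combination key + f 0 * hinv
  · intro y hy
    simpa [Complex.mem_reProdIm, hab] using hy
  · intro y h
    simpa [ha.ne'] using congrArg Complex.re h
  · intro y hy
    simpa [Complex.mem_reProdIm, hab] using hy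
  · intro y h
    simpa [hb.ne'] using congrArg Complex.re h
  · intro y hy
    simpa [Complex.mem_reProdIm, hBB] using hy
  · intro y h
    simpa [hB.ne'] using congrArg Complex.im h
  · intro y hy
    simpa [Complex.mem_reProdIm, hBB] using hy
  · intro y h
    simpa [hB.ne'] using congrArg Complex.im h

lemma norm_rectIntegral_le {a b B E F : ℝ} {f : ℂ → ℂ} {g : ℝ → ℝ} (hab : -a ≤ b) (hB : 0 ≤ B)
    (hE : ∀ x ∈ Set.Icc (-a) b, ∀ y : ℝ, |y| = B → ‖f (x + y * I)‖ ≤ E)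
    (hF : ∀ y ∈ Set.Icc (-B) B, ‖f (b + y * I)‖ ≤ F)
    (hg : ∀ y ∈ Set.Icc (-B) B, ‖f ((-a : ℝ) + y * I)‖ ≤ g y)
    (hgi : IntervalIntegrable g MeasureTheory.volume (-B) B) :
    ‖rectIntegral a b B f‖ ≤ 2 * (a + b) * E + 2 * B * F + ∫ y in (-B)..B, g y := by
  have hBB : -B ≤ B := by linarith
  have h1 : ‖∫ x in (-a)..b, f (x + (-B : ℝ) * I)‖ ≤ E * |b - -a| :=
    intervalIntegral.norm_integral_le_of_norm_le_const fun x hx ↦ by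
      rw [Set.uIoc_of_le hab] at hx
      exact hE x (Set.Ioc_subset_Icc_self hx) (-B) (by rw [abs_neg, abs_of_nonneg hB])
  have h2 : ‖∫ x in (-a)..b, f (x + B * I)‖ ≤ E * |b - -a| :=
    intervalIntegral.norm_integral_le_of_norm_le_const fun x hx ↦ by
      rw [Set.uIoc_of_le hab] at hx
      exact hE x (Set.Ioc_subset_Icc_self hx) B (abs_of_nonneg hB)
  have h3 : ‖∫ y in (-B)..B, f (b + y * I)‖ ≤ F * |B - -B| :=
    intervalIntegral.norm_integral_le_of_norm_le_const fun y hy ↦ by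
      rw [Set.uIoc_of_le hBB] at hy
      exact hF y (Set.Ioc_subset_Icc_self hy)
  have h4 : ‖∫ y in (-B)..B, f ((-a : ℝ) + y * I)‖ ≤ ∫ y in (-B)..B, g y :=
    intervalIntegral.norm_integral_le_of_norm_le hBB
      (Filter.Eventually.of_forall fun y hy ↦ hg y (Set.Ioc_subset_Icc_self hy)) hgi
  rw [abs_of_nonneg (by linarith)] at h1 h2 h3
  rw [rectIntegral]
  refine (norm_sub_le _ _).trans ?_
  refine (add_le_add (norm_add_le _ _) le_rfl).trans ?_
  refine (add_le_add (add_le_add (norm_sub_le _ _) le_rfl) le_rfl).trans ?_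
  rw [norm_mul, norm_mul, norm_I, one_mul, one_mul]
  linarith

lemma norm_cexp_mul_add_sq (L u κ x y : ℝ) :
    ‖Complex.exp (L * (u * (x + y * I) + κ * (x + y * I) ^ 2))‖ =
      Real.exp (L * (u * x + κ * (x ^ 2 - y ^ 2))) := by
  rw [Complex.norm_exp]
  congr 1
  simp [sq]

set_option maxHeartbeats 400000 in
/-- A zero to the right of the critical line forces the mollified zeta function to have large
mean square near the ordinate of this zero. -/
lemma exists_one_le_mul_integral {σ η : ℝ} (hσ : 1 / 2 < σ) (hη : 0 < η) (hη1 : η ≤ 1) :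
    ∃ B C T₀ : ℝ, 0 < B ∧ 0 < C ∧ 2 + B ≤ T₀ ∧ ∀ (T : ℝ) (ρ : ℂ), riemannZeta ρ = 0 → σ ≤ ρ.re →
      T₀ < ρ.im → ρ.im ≤ T →
      1 ≤ C * T ^ (1 - 2 * σ + η) * ∫ t in (ρ.im - B)..(ρ.im + B),
        ‖riemannZeta (1 / 2 + t * I) * mollifier ⌊T⌋₊ (1 / 2 + t * I) - 1‖ ^ 2 := by
  obtain ⟨c, hc⟩ : ∃ c : ℝ, c = 6 / η := ⟨_, rfl⟩
  obtain ⟨κ, hκ⟩ : ∃ κ : ℝ, κ = η ^ 2 / 36 := ⟨_, rfl⟩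
  obtain ⟨B, hB⟩ : ∃ B : ℝ, B = c * (2 * c + 6) := ⟨_, rfl⟩
  have hηc : η * c = 6 := by rw [hc]; field_simp
  have hκc : κ * c ^ 2 = 1 := by rw [hc, hκ]; field_simp; norm_num
  have hc6 : 6 ≤ c := by
    rw [hc, le_div_iff₀ hη]
    linarith
  have hκ0 : 0 ≤ κ := by
    rw [hκ]
    positivity
  have hκB : 2 * c + 6 ≤ κ * B ^ 2 := by
    rw [hB, mul_pow, ← mul_assoc, hκc, one_mul]
    exact le_self_pow₀ (by linarith) two_ne_zero
  have hB1 : 1 ≤ B := hB ▸ one_le_mul_of_one_le_of_one_le (by linarith) (by linarith)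
  obtain ⟨D, hD⟩ : ∃ D : ℝ, D = ∑' n : ℕ, 1 / (n : ℝ) ^ 2 := ⟨_, rfl⟩
  have hD1 : 1 ≤ D := hD ▸ one_le_tsum_one_div_sq
  have hD0 : 0 < D := by linarith
  obtain ⟨T₀, hT₀⟩ : ∃ T₀ : ℝ, T₀ = 2 + B + c + 100 * c + 2 * B * (D ^ 4 * 2 ^ (2 * c)) := ⟨_, rfl⟩
  have hB0 : 0 < B := by linarith
  have hBD : 0 < 2 * B * (D ^ 4 * 2 ^ (2 * c)) := by positivity
  refine ⟨B, 1 / (σ - 1 / 2), T₀, hB0, by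
    have : 0 < σ - 1 / 2 := by linarith
    positivity, by linarith, fun T ρ hρ hρσ hρT₀ hρT ↦ ?_⟩
  have hβ1 : ρ.re < 1 := by
    by_contra! h
    exact riemannZeta_ne_zero_of_one_le_re h hρ
  have hTT : T₀ < T := hρT₀.trans_le hρT
  have hTc : 2 + B + c ≤ T := by linarith
  have hT1 : 1 ≤ T := by linarith
  have hT0 : 0 < T := by linarith
  obtain ⟨L, hL⟩ : ∃ L : ℝ, L = Real.log T := ⟨_, rfl⟩
  have hexpL (x : ℝ) : Real.exp (L * x) = T ^ x := by
    rw [hL, Real.rpow_def_of_pos hT0]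
  set X := ⌊T⌋₊ with hX
  have hXT : (X : ℝ) ≤ T := Nat.floor_le hT0.le
  have hX1 : 1 ≤ X := Nat.one_le_floor_iff T |>.mpr hT1
  have hX2 : T / 2 ≤ X := by
    have := Nat.lt_floor_add_one T
    have h1 : (1 : ℝ) ≤ X := by exact_mod_cast hX1
    rw [← hX] at this
    linarith
  set h : ℂ → ℂ := fun s ↦ riemannZeta s * mollifier X s - 1 with hh
  obtain ⟨a, ha⟩ : ∃ a : ℝ, a = ρ.re - 1 / 2 := ⟨_, rfl⟩
  obtain ⟨b, hb⟩ : ∃ b : ℝ, b = c - ρ.re := ⟨_, rfl⟩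
  have ha0 : σ - 1 / 2 ≤ a := by linarith
  have ha0' : 0 < a := by linarith
  have hb1 : 1 ≤ b := by linarith
  set k : ℂ → ℂ := fun w ↦ Complex.exp (L * ((2 - η : ℝ) * w + κ * w ^ 2)) with hk
  have hkn (x y : ℝ) : ‖k (x + y * I)‖ = T ^ ((2 - η) * x + κ * (x ^ 2 - y ^ 2)) := by
    rw [← hexpL, hk]
    exact norm_cexp_mul_add_sq L (2 - η) κ x y
  set f : ℂ → ℂ := fun w ↦ h (ρ + w) ^ 2 * k w with hf
  have him (w : ℂ) (hw : w ∈ Set.Icc (-a) b ×ℂ Set.Icc (-B) B) : 1 ≤ (ρ + w).im := by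
    have := hw.2.1
    simp only [Complex.add_im]
    linarith
  have hdiffh (s : ℂ) (hs : 1 ≤ s.im) : DifferentiableAt ℂ h s := by
    have hs1 : s ≠ 1 := by
      rintro rfl
      simp at hs
      linarith
    exact ((differentiableAt_riemannZeta hs1).mul (differentiable_mollifier X s)).sub_const 1
  have hdiff (w : ℂ) (hw : w ∈ Set.Icc (-a) b ×ℂ Set.Icc (-B) B) : DifferentiableAt ℂ f w := by
    have h1 : DifferentiableAt ℂ (fun w ↦ h (ρ + w)) w :=
      (hdiffh (ρ + w) (him w hw)).comp w (by fun_prop)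
    exact (h1.pow 2).mul (by fun_prop)
  have hcauchy := rectIntegral_mul_inv ha0' (by linarith) (by linarith) hdiff
  have hf0 : f 0 = 1 := by simp [hf, hh, hk, hρ]
  have hhor (x : ℝ) (hx : x ∈ Set.Icc (-a) b) (y : ℝ) (hy : |y| = B) :
      ‖f (x + y * I) * (x + y * I)⁻¹‖ ≤ 49 / T := by
    set s : ℂ := ρ + (x + y * I) with hs
    have hsre : s.re = ρ.re + x := by simp [hs]
    have hsim : s.im = ρ.im + y := by simp [hs]
    have hyB := abs_le.mp hy.le
    have hre : 1 / 2 ≤ s.re := by rw [hsre]; linarith [hx.1]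
    have hre' : s.re ≤ c := by rw [hsre]; linarith [hx.2]
    have hsim1 : 1 ≤ s.im := by rw [hsim]; linarith
    have hsn : ‖s‖ ≤ 2 * T := by
      refine (Complex.norm_le_abs_re_add_abs_im s).trans ?_
      rw [abs_of_nonneg (by linarith), abs_of_nonneg (by linarith), hsim]
      linarith
    have hz : ‖riemannZeta s‖ ≤ 6 * T := by
      refine (norm_riemannZeta_le (by linarith) (by rwa [abs_of_nonneg (by linarith)])).trans ?_
      have h3 : 1 / s.re ≤ 2 := by
        rw [div_le_iff₀ (by linarith)]
        linarith
      calc ‖s‖ * (1 + 1 / s.re) ≤ (2 * T) * (1 + 2) := by gcongr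
        _ = 6 * T := by ring
    have hm : ‖mollifier X s‖ ≤ T := (norm_mollifier_le X (by linarith)).trans hXT
    have hhs : ‖h s‖ ≤ 7 * T ^ 2 := by
      refine (norm_sub_le _ _).trans ?_
      rw [norm_mul, norm_one]
      have := mul_le_mul hz hm (norm_nonneg _) (by positivity)
      have : 1 ≤ T ^ 2 := one_le_pow₀ hT1
      linarith
    have hw : 1 ≤ ‖(x : ℂ) + y * I‖ := by
      refine hB1.trans (hy ▸ ?_)
      simpa using Complex.abs_im_le_norm ((x : ℂ) + y * I)
    have hkb : ‖k (x + y * I)‖ ≤ T ^ (-5 : ℝ) := by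
      rw [hkn]
      refine Real.rpow_le_rpow_of_exponent_le hT1 ?_
      have hyy : y ^ 2 = B ^ 2 := by rw [← hy, sq_abs]
      have hxc : x ≤ c := by linarith [hx.2]
      have hxc' : -c ≤ x := by linarith [hx.1]
      have hxx : κ * x ^ 2 ≤ 1 := by
        rw [← hκc]
        exact mul_le_mul_of_nonneg_left (sq_le_sq' hxc' hxc) hκ0
      have : (2 - η) * x ≤ (2 - η) * c := mul_le_mul_of_nonneg_left hxc (by linarith)
      rw [hyy]
      linarith
    rw [norm_mul, norm_inv, norm_mul, norm_pow]
    calc ‖h s‖ ^ 2 * ‖k (x + y * I)‖ * ‖(x : ℂ) + y * I‖⁻¹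
        ≤ (7 * T ^ 2) ^ 2 * T ^ (-5 : ℝ) * 1 := by
          gcongr
          exact inv_le_one_of_one_le₀ hw
      _ = 49 / T := by
          rw [Real.rpow_neg hT0.le, show (5 : ℝ) = (5 : ℕ) by norm_num, Real.rpow_natCast]
          field_simp
          norm_num
  have hright (y : ℝ) (hy : y ∈ Set.Icc (-B) B) :
      ‖f (b + y * I) * (b + y * I)⁻¹‖ ≤ D ^ 4 * 2 ^ (2 * c) / T := by
    set s : ℂ := ρ + (b + y * I) with hs
    have hsre : s.re = c := by simp [hs, hb]
    have hhs : ‖h s‖ ≤ D ^ 2 * (T / 2) ^ (2 - c) := by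
      refine (norm_riemannZeta_mul_mollifier_sub_one_le hX1 (by linarith)).trans ?_
      rw [hsre, ← hD]
      refine mul_le_mul_of_nonneg_left ?_ (by positivity)
      exact Real.rpow_le_rpow_of_nonpos (by positivity) hX2 (by linarith)
    have hw : 1 ≤ ‖(b : ℂ) + y * I‖ := by
      refine hb1.trans ((le_abs_self b).trans ?_)
      simpa using Complex.abs_re_le_norm ((b : ℂ) + y * I)
    have hkb : ‖k (b + y * I)‖ ≤ T ^ (2 * c - 5) := by
      rw [hkn]
      refine Real.rpow_le_rpow_of_exponent_le hT1 ?_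
      have hbc : κ * b ^ 2 ≤ 1 := by
        rw [← hκc]
        exact mul_le_mul_of_nonneg_left (sq_le_sq' (by linarith) (by linarith)) hκ0
      have hyy : 0 ≤ κ * y ^ 2 := by positivity
      have : (2 - η) * b ≤ (2 - η) * c := mul_le_mul_of_nonneg_left (by linarith) (by linarith)
      linarith
    rw [norm_mul, norm_inv, norm_mul, norm_pow]
    calc ‖h s‖ ^ 2 * ‖k (b + y * I)‖ * ‖(b : ℂ) + y * I‖⁻¹
        ≤ (D ^ 2 * (T / 2) ^ (2 - c)) ^ 2 * T ^ (2 * c - 5) * 1 := by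
          gcongr
          exact inv_le_one_of_one_le₀ hw
      _ = D ^ 4 * 2 ^ (2 * c - 4) / T := by
          rw [mul_pow, ← pow_mul, ← Real.rpow_natCast (_ ^ (2 - c)), ← Real.rpow_mul (by positivity),
            Real.div_rpow hT0.le zero_le_two, show (2 - c) * (2 : ℕ) = -(2 * c - 4) by
              push_cast; ring, Real.rpow_neg zero_le_two, Real.rpow_neg hT0.le,
            show 2 * c - 5 = (2 * c - 4) - 1 by ring, Real.rpow_sub_one hT0.ne']
          field_simp
      _ ≤ _ := by
          gcongr
          · norm_num
          · linarith
  set g : ℝ → ℝ := fun y ↦ T ^ (1 - 2 * σ + η) / (σ - 1 / 2) *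
    ‖h (1 / 2 + (ρ.im + y : ℝ) * I)‖ ^ 2 with hg
  have hleft (y : ℝ) (hy : y ∈ Set.Icc (-B) B) :
      ‖f ((-a : ℝ) + y * I) * ((-a : ℝ) + y * I)⁻¹‖ ≤ g y := by
    have hs : ρ + ((-a : ℝ) + y * I) = 1 / 2 + (ρ.im + y : ℝ) * I := by
      apply Complex.ext <;> simp [ha]
    have hw : σ - 1 / 2 ≤ ‖((-a : ℝ) : ℂ) + y * I‖ := by
      refine ha0.trans ((neg_neg a ▸ neg_le_abs (-a)).trans ?_)
      simpa using Complex.abs_re_le_norm (((-a : ℝ) : ℂ) + y * I)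
    have hkb : ‖k ((-a : ℝ) + y * I)‖ ≤ T ^ (1 - 2 * σ + η) := by
      rw [hkn]
      refine Real.rpow_le_rpow_of_exponent_le hT1 ?_
      have hyy : 0 ≤ κ * y ^ 2 := by positivity
      have haa : κ * (-a) ^ 2 ≤ κ := by
        rw [neg_sq]
        exact mul_le_of_le_one_right hκ0 (pow_le_one₀ ha0'.le (by linarith))
      have hκη : κ ≤ η / 2 := by
        have : η ^ 2 ≤ η := by
          rw [sq]
          exact mul_le_of_le_one_left hη.le hη1
        linarith
      have h1 : (2 - η) * (σ - 1 / 2) ≤ (2 - η) * a :=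
        mul_le_mul_of_nonneg_left ha0 (by linarith)
      have h2 : η * (σ - 1 / 2) ≤ η * (1 / 2) := mul_le_mul_of_nonneg_left (by linarith) hη.le
      linarith
    rw [norm_mul, norm_inv, norm_mul, norm_pow, hs]
    calc ‖h (1 / 2 + (ρ.im + y : ℝ) * I)‖ ^ 2 * ‖k ((-a : ℝ) + y * I)‖ *
          ‖((-a : ℝ) : ℂ) + y * I‖⁻¹
        ≤ ‖h (1 / 2 + (ρ.im + y : ℝ) * I)‖ ^ 2 * T ^ (1 - 2 * σ + η) * (σ - 1 / 2)⁻¹ := by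
          gcongr
      _ = g y := by
          rw [hg]
          ring
  have hgi : IntervalIntegrable g MeasureTheory.volume (-B) B := by
    refine ContinuousOn.intervalIntegrable fun y hy ↦ ContinuousAt.continuousWithinAt ?_
    rw [Set.uIcc_of_le (by linarith)] at hy
    have h1 : ContinuousAt (fun y : ℝ ↦ h (1 / 2 + (ρ.im + y : ℝ) * I)) y :=
      ContinuousAt.comp (f := fun y : ℝ ↦ (1 / 2 + (ρ.im + y : ℝ) * I : ℂ))
        (hdiffh _ (by simp; linarith [hy.1])).continuousAt (by fun_prop)
    exact continuousAt_const.mul (h1.norm.pow 2)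
  have hbound := norm_rectIntegral_le (a := a) (b := b) (B := B)
    (f := fun w ↦ f w * w⁻¹) (by linarith) (by linarith) hhor hright hleft hgi
  rw [hcauchy, hf0, mul_one, norm_mul, norm_mul, norm_I, mul_one, Complex.norm_real,
    Real.norm_of_nonneg Real.pi_pos.le, RCLike.norm_ofNat] at hbound
  have hsmall : 2 * (a + b) * (49 / T) + 2 * B * (D ^ 4 * 2 ^ (2 * c) / T) ≤ 1 := by
    have : a + b ≤ c := by linarith
    calc _ = (98 * (a + b) + 2 * B * (D ^ 4 * 2 ^ (2 * c))) / T := by ring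
      _ ≤ 1 := by
        rw [div_le_one hT0]
        linarith
  have hint : ∫ y in (-B)..B, g y = 1 / (σ - 1 / 2) * T ^ (1 - 2 * σ + η) *
      ∫ t in (ρ.im - B)..(ρ.im + B), ‖h (1 / 2 + t * I)‖ ^ 2 := by
    rw [hg, intervalIntegral.integral_const_mul,
      intervalIntegral.integral_comp_add_left (fun t : ℝ ↦ ‖h (1 / 2 + t * I)‖ ^ 2), ← sub_eq_add_neg]
    ring
  rw [← hint]
  linarith [Real.pi_gt_three]

/-- If `g` has integral at least `1 / A` over every window of radius `B` around an ordinate of a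
point of `S`, and every point lies in at most `N` windows, then `S` is small. -/
lemma card_le_of_one_le_integral {S : Finset ℂ} {g : ℝ → ℝ} {A B N p q : ℝ} (hA : 0 ≤ A)
    (hB : 0 ≤ B) (hpq : p ≤ q) (hg : ContinuousOn g (Set.Icc p q)) (hg0 : ∀ t, 0 ≤ g t)
    (hS : ∀ ρ ∈ S, p ≤ ρ.im - B ∧ ρ.im + B ≤ q)
    (hN : ∀ t ∈ Set.Icc p q, ((S.filter fun ρ ↦ |ρ.im - t| ≤ B).card : ℝ) ≤ N)
    (h1 : ∀ ρ ∈ S, 1 ≤ A * ∫ t in (ρ.im - B)..(ρ.im + B), g t) :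
    (S.card : ℝ) ≤ A * (N * ∫ t in p..q, g t) := by
  have hgi : MeasureTheory.IntegrableOn g (Set.Icc p q) := hg.integrableOn_Icc
  have heq (ρ : ℂ) (hρ : ρ ∈ S) : ∫ t in (ρ.im - B)..(ρ.im + B), g t =
      ∫ t in Set.Icc p q, (Set.Icc (ρ.im - B) (ρ.im + B)).indicator g t := by
    rw [intervalIntegral.integral_of_le (by linarith), ← MeasureTheory.integral_Icc_eq_integral_Ioc,
      MeasureTheory.setIntegral_indicator measurableSet_Icc, Set.inter_eq_right.mpr]
    exact Set.Icc_subset_Icc (hS ρ hρ).1 (hS ρ hρ).2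
  have hpt (t : ℝ) (ht : t ∈ Set.Icc p q) :
      ∑ ρ ∈ S, (Set.Icc (ρ.im - B) (ρ.im + B)).indicator g t ≤ N * g t := by
    refine le_trans (le_of_eq ?_) (mul_le_mul_of_nonneg_right (hN t ht) (hg0 t))
    rw [← nsmul_eq_mul, ← Finset.sum_const, Finset.sum_filter]
    refine Finset.sum_congr rfl fun ρ _ ↦ ?_
    rw [Set.indicator_apply]
    refine if_congr ?_ rfl rfl
    rw [Set.mem_Icc, abs_le]
    constructor <;> rintro ⟨h, h'⟩ <;> constructor <;> linarith
  calc (S.card : ℝ) = ∑ ρ ∈ S, (1 : ℝ) := by simp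
    _ ≤ ∑ ρ ∈ S, A * ∫ t in (ρ.im - B)..(ρ.im + B), g t := Finset.sum_le_sum h1
    _ = A * ∫ t in Set.Icc p q, ∑ ρ ∈ S, (Set.Icc (ρ.im - B) (ρ.im + B)).indicator g t := by
        rw [← Finset.mul_sum, Finset.sum_congr rfl heq, MeasureTheory.integral_finsetSum]
        exact fun ρ _ ↦ hgi.indicator measurableSet_Icc
    _ ≤ A * ∫ t in Set.Icc p q, N * g t := by
        refine mul_le_mul_of_nonneg_left ?_ hA
        refine MeasureTheory.setIntegral_mono_on ?_ (hgi.const_mul N) measurableSet_Icc hpt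
        exact MeasureTheory.integrable_finsetSum _ fun ρ _ ↦ hgi.indicator measurableSet_Icc
    _ = A * (N * ∫ t in p..q, g t) := by
        rw [MeasureTheory.integral_const_mul, MeasureTheory.integral_Icc_eq_integral_Ioc,
          intervalIntegral.integral_of_le hpq]

lemma finite_riemannZeta_zeros {σ : ℝ} (T : ℝ) :
    {ρ : ℂ | riemannZeta ρ = 0 ∧ σ ≤ ρ.re ∧ 0 < ρ.im ∧ ρ.im ≤ T}.Finite := by
  have hK : IsCompact (Set.Icc σ 1 ×ℂ Set.Icc 0 T) := isCompact_Icc.reProdIm isCompact_Icc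
  refine hK.inter_riemannZetaZeros_finite.subset fun ρ ⟨h0, h1, h2, h3⟩ ↦ ?_
  refine ⟨⟨⟨h1, ?_⟩, h2.le, h3⟩, h0⟩
  by_contra! h
  exact riemannZeta_ne_zero_of_one_le_re h.le h0

/-- If every zero contributes a definite amount to the integral of a function `g T` near its
ordinate, a bound for the integral of `g T` yields a bound for the number of zeros. -/
lemma exists_natCard_zeros_le {σ B A T₀ K u v η e : ℝ} (hσ : 1 / 2 ≤ σ) (hB : 0 < B)
    (hA : 0 ≤ A) (hK : 0 ≤ K) (hη : 0 < η) (he : 0 ≤ e) (huv : u + v + η ≤ e) (g : ℝ → ℝ → ℝ)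
    (hg : ∀ T, ContinuousOn (g T) (Set.Ici 2)) (hg0 : ∀ T t, 0 ≤ g T t)
    (hint : ∀ T p, 2 ≤ p → p ≤ 2 * T → ∫ t in p..2 * T, g T t ≤ K * T ^ v)
    (h1 : ∀ (T : ℝ) (ρ : ℂ), riemannZeta ρ = 0 → σ ≤ ρ.re → T₀ < ρ.im → ρ.im ≤ T →
      1 ≤ A * T ^ u * ∫ t in (ρ.im - B)..(ρ.im + B), g T t) :
    ∃ C : ℝ, 0 < C ∧ ∀ T : ℝ, 2 ≤ T →
      (Nat.card {ρ : ℂ | riemannZeta ρ = 0 ∧ σ ≤ ρ.re ∧ 0 < ρ.im ∧ ρ.im ≤ T} : ℝ) ≤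
        C * T ^ e := by
  obtain ⟨C, t₀, hC, ht₀, hcount⟩ := exists_card_zeros_le_mul_log hB
  set T₁ : ℝ := max T₀ (t₀ + B) with hT₁
  have hT₁0 : T₀ ≤ T₁ := le_max_left _ _
  have hT₁t : t₀ + B ≤ T₁ := le_max_right _ _
  set Z : ℝ → Set ℂ :=
    fun T ↦ {ρ : ℂ | riemannZeta ρ = 0 ∧ σ ≤ ρ.re ∧ 0 < ρ.im ∧ ρ.im ≤ T} with hZ
  have hfin (T : ℝ) : (Z T).Finite := finite_riemannZeta_zeros T
  set F : Finset ℂ := (hfin T₁).toFinset with hF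
  refine ⟨F.card + 1 + A * (C * (2 ^ η / η) * K), by positivity, fun T hT ↦ ?_⟩
  have hT0 : 0 < T := by linarith
  have hT1 : 1 ≤ T := by linarith
  have hTe : 1 ≤ T ^ e := Real.one_le_rpow hT1 he
  set S : Finset ℂ := (hfin T).toFinset.filter fun ρ ↦ T₁ < ρ.im with hS
  have hSmem {ρ : ℂ} (hρ : ρ ∈ S) :
      riemannZeta ρ = 0 ∧ σ ≤ ρ.re ∧ T₁ < ρ.im ∧ ρ.im ≤ T := by
    rw [hS, Finset.mem_filter, Set.Finite.mem_toFinset] at hρ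
    exact ⟨hρ.1.1, hρ.1.2.1, hρ.2, hρ.1.2.2.2⟩
  have hcard : (Nat.card (Z T) : ℝ) ≤ F.card + S.card := by
    rw [Nat.card_coe_set_eq, Set.ncard_eq_toFinset_card _ (hfin T)]
    have hsub : (hfin T).toFinset ⊆ F ∪ S := by
      intro ρ hρ
      rw [Finset.mem_union]
      by_cases h : T₁ < ρ.im
      · exact Or.inr (Finset.mem_filter.mpr ⟨hρ, h⟩)
      · rw [Set.Finite.mem_toFinset] at hρ
        exact Or.inl ((hfin T₁).mem_toFinset.mpr ⟨hρ.1, hρ.2.1, hρ.2.2.1, not_lt.mp h⟩)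
    exact_mod_cast (Finset.card_le_card hsub).trans (Finset.card_union_le _ _)
  have hScard : (S.card : ℝ) ≤ A * (C * (2 ^ η / η) * K) * T ^ e := by
    rcases S.eq_empty_or_nonempty with h | ⟨ρ₀, hρ₀⟩
    · rw [h]
      simp only [Finset.card_empty, Nat.cast_zero]
      positivity
    have hTT : T₁ < T := (hSmem hρ₀).2.2.1.trans_le (hSmem hρ₀).2.2.2
    have hlog : Real.log (2 * T) ≤ 2 ^ η / η * T ^ η := by
      refine (Real.log_le_rpow_div (by positivity) hη).trans_eq ?_
      rw [Real.mul_rpow zero_le_two hT0.le]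
      ring
    have key := card_le_of_one_le_integral (S := S) (g := g T) (A := A * T ^ u) (B := B)
      (N := C * Real.log (2 * T)) (p := t₀) (q := 2 * T) (by positivity) hB.le (by linarith)
      ((hg T).mono fun t ht ↦ ht₀.trans ht.1) (hg0 T)
      (fun ρ hρ ↦ by
        obtain ⟨-, -, h3, h4⟩ := hSmem hρ
        constructor <;> linarith)
      (fun t ht ↦ by
        refine (hcount t ht.1 _ fun ρ hρ ↦ ?_).trans ?_
        · rw [Finset.mem_filter] at hρ
          obtain ⟨h0, h2, -, -⟩ := hSmem hρ.1
          exact ⟨h0, hσ.trans h2, hρ.2⟩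
        · have := Real.log_le_log (by linarith [ht.1]) ht.2
          gcongr)
      (fun ρ hρ ↦ by
        obtain ⟨h0, h2, h3, h4⟩ := hSmem hρ
        exact h1 T ρ h0 h2 (hT₁0.trans_lt h3) h4)
    calc (S.card : ℝ) ≤ A * T ^ u * (C * Real.log (2 * T) * ∫ t in t₀..2 * T, g T t) := key
      _ ≤ A * T ^ u * (C * (2 ^ η / η * T ^ η) * (K * T ^ v)) := by
          have h3 := hint T t₀ ht₀ (by linarith)
          refine mul_le_mul_of_nonneg_left ?_ (by positivity)
          exact mul_le_mul (mul_le_mul_of_nonneg_left hlog hC.le) h3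
            (intervalIntegral.integral_nonneg (by linarith) fun t _ ↦ hg0 T t) (by positivity)
      _ = A * (C * (2 ^ η / η) * K) * T ^ (u + v + η) := by
          rw [Real.rpow_add hT0, Real.rpow_add hT0]
          ring
      _ ≤ _ := mul_le_mul_of_nonneg_left (Real.rpow_le_rpow_of_exponent_le hT1 huv)
          (by positivity)
  refine hcard.trans ?_
  have : (F.card : ℝ) * 1 ≤ F.card * T ^ e := by gcongr
  linarith

lemma continuous_riemannZeta_criticalLine :
    Continuous fun t : ℝ ↦ riemannZeta (1 / 2 + t * I) := by
  refine continuous_iff_continuousAt.mpr fun t ↦ ?_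
  refine ContinuousAt.comp (f := fun t : ℝ ↦ (1 / 2 + t * I : ℂ))
    (differentiableAt_riemannZeta fun h ↦ ?_).continuousAt (by fun_prop)
  have := congrArg Complex.re h
  norm_num at this

/-- Mean square of the mollified zeta function on the critical line, from a pointwise bound. -/
lemma exists_integral_norm_sq_le {η C : ℝ} (hη : 0 < η)
    (hC : ∀ t : ℝ, 2 ≤ t → ‖riemannZeta (1 / 2 + t * I)‖ ≤ C * t ^ η) :
    ∃ K : ℝ, 0 ≤ K ∧ ∀ T p : ℝ, 2 ≤ p → p ≤ 2 * T →
      ∫ t in p..2 * T, ‖riemannZeta (1 / 2 + t * I) * mollifier ⌊T⌋₊ (1 / 2 + t * I) - 1‖ ^ 2 ≤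
        K * T ^ (1 + 4 * η) := by
  refine ⟨2 * (C * 2 ^ η) ^ 2 * (6 * (1 + 1 / η) ^ 2) + 4, by positivity, fun T p hp hpT ↦ ?_⟩
  have hT1 : 1 ≤ T := by linarith
  have hT0 : 0 < T := by linarith
  set X := ⌊T⌋₊ with hX
  have hXT : (X : ℝ) ≤ T := Nat.floor_le hT0.le
  have hX1 : (1 : ℝ) ≤ X := by exact_mod_cast (Nat.one_le_floor_iff T).mpr hT1
  have hlX0 : 0 ≤ Real.log X := Real.log_nonneg hX1
  have hlX : 1 + Real.log X ≤ (1 + 1 / η) * T ^ η := by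
    have h1 : Real.log X ≤ T ^ η / η :=
      (Real.log_le_log (by linarith) hXT).trans (Real.log_le_rpow_div hT0.le hη)
    have h2 : 1 ≤ T ^ η := Real.one_le_rpow hT1 hη.le
    calc 1 + Real.log X ≤ T ^ η + T ^ η / η := add_le_add h2 h1
      _ = _ := by ring
  have hcm : Continuous fun t : ℝ ↦ mollifier X (1 / 2 + t * I) :=
    (differentiable_mollifier X).continuous.comp (by fun_prop)
  have hpt (t : ℝ) (ht : t ∈ Set.Icc p (2 * T)) :
      ‖riemannZeta (1 / 2 + t * I) * mollifier X (1 / 2 + t * I) - 1‖ ^ 2 ≤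
        2 * (C * (2 * T) ^ η) ^ 2 * ‖mollifier X (1 / 2 + t * I)‖ ^ 2 + 2 := by
    have ht2 : 2 ≤ t := hp.trans ht.1
    have hC0 : 0 ≤ C := by
      have h := (norm_nonneg _).trans (hC t ht2)
      exact nonneg_of_mul_nonneg_left h (by positivity)
    have hz : ‖riemannZeta (1 / 2 + t * I)‖ ≤ C * (2 * T) ^ η := by
      refine (hC t ht2).trans (mul_le_mul_of_nonneg_left ?_ hC0)
      exact Real.rpow_le_rpow (by linarith) ht.2 hη.le
    have h1 : ‖riemannZeta (1 / 2 + t * I) * mollifier X (1 / 2 + t * I) - 1‖ ≤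
        C * (2 * T) ^ η * ‖mollifier X (1 / 2 + t * I)‖ + 1 := by
      refine (norm_sub_le _ _).trans ?_
      rw [norm_mul, norm_one]
      gcongr
    refine (pow_le_pow_left₀ (norm_nonneg _) h1 2).trans ?_
    have := add_sq_le (a := C * (2 * T) ^ η * ‖mollifier X (1 / 2 + t * I)‖) (b := 1)
    linarith
  have hm := integral_norm_sq_mollifier_le X hpT
  have hm' : ∫ t in p..2 * T, ‖mollifier X (1 / 2 + t * I)‖ ^ 2 ≤
      6 * (1 + 1 / η) ^ 2 * T ^ (1 + 2 * η) := by
    refine hm.trans ?_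
    calc (1 + Real.log X) * ((2 * T - p) + 4 * X * (1 + Real.log X))
        ≤ (1 + Real.log X) * (2 * T * (1 + Real.log X) + 4 * T * (1 + Real.log X)) := by
          gcongr
          have : 2 * T * 1 ≤ 2 * T * (1 + Real.log X) := by gcongr; linarith
          linarith
      _ = 6 * T * (1 + Real.log X) ^ 2 := by ring
      _ ≤ 6 * T * ((1 + 1 / η) * T ^ η) ^ 2 := by gcongr
      _ = 6 * (1 + 1 / η) ^ 2 * T ^ (1 + 2 * η) := by
          rw [Real.rpow_add hT0, Real.rpow_one, mul_comm 2 η, Real.rpow_mul hT0.le, Real.rpow_two]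
          ring
  calc ∫ t in p..2 * T, ‖riemannZeta (1 / 2 + t * I) * mollifier X (1 / 2 + t * I) - 1‖ ^ 2
      ≤ ∫ t in p..2 * T,
        (2 * (C * (2 * T) ^ η) ^ 2 * ‖mollifier X (1 / 2 + t * I)‖ ^ 2 + 2) := by
        refine intervalIntegral.integral_mono_on hpT ?_ ?_ hpt
        · exact (((continuous_riemannZeta_criticalLine.mul hcm).sub
            continuous_const).norm.pow 2).intervalIntegrable _ _
        · exact Continuous.intervalIntegrable (by fun_prop) _ _
    _ = 2 * (C * (2 * T) ^ η) ^ 2 * (∫ t in p..2 * T, ‖mollifier X (1 / 2 + t * I)‖ ^ 2) +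
        2 * (2 * T - p) := by
        rw [intervalIntegral.integral_add
          (Continuous.intervalIntegrable (by fun_prop) _ _) intervalIntegrable_const,
          intervalIntegral.integral_const_mul, intervalIntegral.integral_const, smul_eq_mul]
        ring
    _ ≤ 2 * (C * (2 * T) ^ η) ^ 2 * (6 * (1 + 1 / η) ^ 2 * T ^ (1 + 2 * η)) + 4 * T := by
        exact add_le_add (mul_le_mul_of_nonneg_left hm' (by positivity)) (by linarith)
    _ = 2 * (C * 2 ^ η) ^ 2 * (6 * (1 + 1 / η) ^ 2) * T ^ (1 + 4 * η) + 4 * T ^ (1 : ℝ) := by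
        rw [show 1 + 4 * η = (1 + 2 * η) + η * 2 by ring, Real.rpow_add hT0 _ (η * 2),
          Real.rpow_mul hT0.le, Real.rpow_two, Real.mul_rpow zero_le_two hT0.le, Real.rpow_one]
        ring
    _ ≤ 2 * (C * 2 ^ η) ^ 2 * (6 * (1 + 1 / η) ^ 2) * T ^ (1 + 4 * η) + 4 * T ^ (1 + 4 * η) := by
        have := Real.rpow_le_rpow_of_exponent_le hT1 (by linarith : 1 ≤ 1 + 4 * η)
        linarith
    _ = _ := by ring

/-- The Lindelöf Hypothesis implies the Density Hypothesis: if
`ζ(1/2+it) = O(t^ε)` for every `ε > 0`, then for `1/2 ≤ σ ≤ 1` the number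
`N(σ,T)` of zeros `ρ` of `ζ` with `Re ρ ≥ σ`, `0 < Im ρ ≤ T` satisfies
`N(σ,T) = O(T^(2-2σ+ε))` for every `ε > 0`. -/
theorem stmt_18
    (LH : ∀ ε : ℝ, 0 < ε → ∃ C : ℝ, 0 < C ∧ ∀ t : ℝ, 2 ≤ t →
        ‖riemannZeta (1/2 + t * I)‖ ≤ C * t ^ ε) :
    ∀ σ : ℝ, 1/2 ≤ σ → σ ≤ 1 → ∀ ε : ℝ, 0 < ε →
      ∃ C : ℝ, 0 < C ∧ ∀ T : ℝ, 2 ≤ T →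
        (Nat.card {ρ : ℂ | riemannZeta ρ = 0 ∧ σ ≤ ρ.re ∧ 0 < ρ.im ∧ ρ.im ≤ T} : ℝ)
          ≤ C * T ^ (2 - 2 * σ + ε) := by
  intro σ hσ hσ1 ε hε
  rcases hσ.eq_or_lt with rfl | hσ'
  · refine exists_natCard_zeros_le (B := 1) (A := 1) (T₀ := 0) (K := 2) (u := 0) (v := 1)
      (η := ε) le_rfl one_pos zero_le_one zero_le_two hε (by linarith) (by linarith)
      (fun _ _ ↦ 1) (fun _ ↦ continuousOn_const) (fun _ _ ↦ zero_le_one) ?_ ?_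
    · intro T p hp hpT
      simp only [intervalIntegral.integral_const, smul_eq_mul, mul_one, Real.rpow_one]
      linarith
    · intro T ρ _ _ _ _
      simp only [intervalIntegral.integral_const, smul_eq_mul, mul_one, Real.rpow_zero]
      linarith
  · set η : ℝ := min (ε / 6) 1 with hη
    have hη0 : 0 < η := lt_min (by linarith) one_pos
    have hηε : η ≤ ε / 6 := min_le_left _ _
    obtain ⟨C, -, hC⟩ := LH η hη0
    obtain ⟨K, hK, hint⟩ := exists_integral_norm_sq_le hη0 hC
    obtain ⟨B, A, T₀, hB, hA, -, h1⟩ := exists_one_le_mul_integral hσ' hη0 (min_le_right _ _)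
    refine exists_natCard_zeros_le hσ hB hA.le hK hη0 (by linarith) (by linarith) _
      (fun T ↦ ?_) (fun T t ↦ sq_nonneg _) hint h1
    have hm : Continuous fun t : ℝ ↦ mollifier ⌊T⌋₊ (1 / 2 + t * I) :=
      (differentiable_mollifier _).continuous.comp (by fun_prop)
    exact (((continuous_riemannZeta_criticalLine.mul hm).sub continuous_const).norm.pow 2).continuousOn
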